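/- Fix n ∈ ℕ. The family of functions ℝⁿ → ℂ indexed by pairs (a, b) with a : Fin n → {0, 1} and b : Fin n → ℕ, where the (a, b)-th function is θ ↦ Π_{i=0}^{n−1} sin(θᵢ)^{aᵢ} · cos(θᵢ)^{bᵢ}, is linearly independent over ℂ. -/

import Mathlib

open Polynomial in
theorem Polynomial.eq_zero_of_eval_cos_eq_zero (P : ℂ[X])
    (h : ∀ x : ℝ, Real.sin x ≠ 0 → P.eval (Real.cos x : ℂ) = 0) : P = 0 := by
  refine P.eq_zero_of_infinite_isRoot
    (((Set.Ioo_infinite (show (-1 : ℝ) < 1 by norm_num)).image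
      Complex.ofReal_injective.injOn).mono ?_)
  rintro _ ⟨y, ⟨hy, hy'⟩, rfl⟩
  have hsin : Real.sin (Real.arccos y) ≠ 0 := by
    rw [Real.sin_arccos]
    exact (Real.sqrt_pos.2 (by nlinarith)).ne'
  simpa [Real.cos_arccos hy.le hy'.le] using h _ hsin

theorem linearIndependent_sin_pow_mul_cos_pow :
    LinearIndependent ℂ (fun p : Fin 2 × ℕ => fun x : ℝ =>
      (Real.sin x : ℂ) ^ (p.1 : ℕ) * (Real.cos x : ℂ) ^ p.2) := by
  classical
  rw [linearIndependent_iff'']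
  intro s g hg hsum
  set t := s.image Prod.snd
  have hst : s ⊆ Finset.univ ×ˢ t := fun p hp =>
    Finset.mem_product.2 ⟨Finset.mem_univ _, Finset.mem_image_of_mem _ hp⟩
  rw [Finset.sum_subset hst fun p _ hp => by rw [hg p hp, zero_smul],
    Finset.sum_product, Fin.sum_univ_two] at hsum
  let P : Fin 2 → Polynomial ℂ := fun a => ∑ b ∈ t, Polynomial.monomial b (g (a, b))
  have heq (x : ℝ) : (P 0).eval (Real.cos x : ℂ)
      + Real.sin x * (P 1).eval (Real.cos x : ℂ) = 0 := by
    have := congrFun hsum x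
    simp only [Pi.add_apply, Finset.sum_apply, Pi.smul_apply, smul_eq_mul, Pi.zero_apply,
      Fin.val_zero, Fin.val_one, pow_zero, pow_one, one_mul] at this
    simp only [P, Polynomial.eval_finsetSum, Polynomial.eval_monomial, Finset.mul_sum]
    rw [← this]
    congr 1
    exact Finset.sum_congr rfl fun b _ => by ring
  have hneg (x : ℝ) : (P 0).eval (Real.cos x : ℂ)
      - Real.sin x * (P 1).eval (Real.cos x : ℂ) = 0 := by
    have := heq (-x)
    rw [Real.cos_neg, Real.sin_neg, Complex.ofReal_neg] at this
    linear_combination this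
  have hP : ∀ a, P a = 0 := by
    refine Fin.forall_fin_two.2 ⟨?_, ?_⟩
    · exact Polynomial.eq_zero_of_eval_cos_eq_zero _ fun x _ => by
        linear_combination (heq x + hneg x) / 2
    · refine Polynomial.eq_zero_of_eval_cos_eq_zero _ fun x hx => ?_
      refine (mul_eq_zero.1 (?_ : (Real.sin x : ℂ) * _ = 0)).resolve_left
        (Complex.ofReal_ne_zero.2 hx)
      linear_combination (heq x - hneg x) / 2
  rintro ⟨a, b⟩
  by_cases hb : b ∈ t
  · have := congrArg (fun p => Polynomial.coeff p b) (hP a)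
    simpa [P, Polynomial.finsetSum_coeff, Polynomial.coeff_monomial, hb] using this
  · exact hg _ fun h => hb (Finset.mem_image_of_mem Prod.snd h)

theorem LinearIndependent.mul_fst_snd {K ι κ X Y : Type*} [Field K] {v : ι → X → K}
    {w : κ → Y → K} (hv : LinearIndependent K v) (hw : LinearIndependent K w) :
    LinearIndependent K (fun p : ι × κ => fun z : X × Y => v p.1 z.1 * w p.2 z.2) := by
  classical
  rw [linearIndependent_iff'']
  intro s g hg hsum
  have hst : s ⊆ s.image Prod.fst ×ˢ s.image Prod.snd := Finset.subset_product
  rw [Finset.sum_subset hst fun p _ hp => by rw [hg p hp, zero_smul],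
    Finset.sum_product] at hsum
  rintro ⟨i, j⟩
  by_cases hij : (i, j) ∈ s
  · have hi := Finset.mem_image_of_mem Prod.fst hij
    have hj := Finset.mem_image_of_mem Prod.snd hij
    refine linearIndependent_iff'.1 hw _ (fun j => g (i, j)) ?_ j hj
    ext y
    refine linearIndependent_iff'.1 hv _
      (fun i => (∑ j ∈ s.image Prod.snd, g (i, j) • w j) y) ?_ i hi
    ext x
    have := congrFun hsum (x, y)
    simp only [Finset.sum_apply, Pi.smul_apply, smul_eq_mul, Pi.zero_apply,
      Finset.sum_mul] at this ⊢
    rw [← this]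
    exact Finset.sum_congr rfl fun i _ => Finset.sum_congr rfl fun j _ => by ring
  · exact hg _ hij

theorem LinearIndependent.prod_eval {K ι X : Type*} [Field K] {v : ι → X → K}
    (hv : LinearIndependent K v) (n : ℕ) :
    LinearIndependent K (fun p : Fin n → ι => fun x : Fin n → X => ∏ i, v (p i) (x i)) := by
  induction n with
  | zero =>
    refine LinearIndependent.of_subsingleton (fun i => i.elim0) fun h => ?_
    simpa using congrFun h (fun i => i.elim0)
  | succ n ih =>
    rw [← linearIndependent_equiv (Fin.consEquiv fun _ : Fin (n + 1) => ι)]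
    refine LinearIndependent.of_comp
      (LinearMap.funLeft K K (Fin.consEquiv fun _ : Fin (n + 1) => X)) ?_
    convert hv.mul_fst_snd ih using 1
    ext p z
    simp [LinearMap.funLeft_apply, Fin.consEquiv, Fin.prod_univ_succ]


/-- For fixed `n`, the family of functions `ℝⁿ → ℂ` indexed by pairs `(a, b)` with
`a : Fin n → {0,1}` and `b : Fin n → ℕ`, where the `(a,b)`-th function is
`θ ↦ ∏ i, sin (θ i) ^ (a i) * cos (θ i) ^ (b i)`, is linearly independent over `ℂ`. -/
theorem multivariate_sin_cos_monomials_linearIndependent (n : ℕ) :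
    LinearIndependent ℂ (fun p : (Fin n → Fin 2) × (Fin n → ℕ) =>
      fun θ : Fin n → ℝ =>
        ∏ i : Fin n, (Real.sin (θ i) : ℂ) ^ ((p.1 i : ℕ)) * (Real.cos (θ i) : ℂ) ^ (p.2 i)) := by
  have hinj : Function.Injective
      (fun (p : (Fin n → Fin 2) × (Fin n → ℕ)) (i : Fin n) => (p.1 i, p.2 i)) := fun p q h =>
    Prod.ext (funext fun i => congrArg Prod.fst (congrFun h i))
      (funext fun i => congrArg Prod.snd (congrFun h i))
  have hli := linearIndependent_sin_pow_mul_cos_pow.prod_eval n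
  have hcomp := hli.comp _ hinj
  simpa only [Function.comp_def] using hcomp
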